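/- arXiv:2210.15174 — 2 statements merged into one kernel-verified Lean document; each statement's English description precedes it below -/
import Mathlib

section
/- Let A ⊆ G = Z_{p^n} × Z_q × Z_r and let i be an integer with 0 ≤ i ≤ n. If χ_{(p^i,1,1)}(A) = 0 and χ_{(p^i,0,1)}(A) = 0, then χ_{p^i,p^n}(A_{jk}) = χ_{p^i,p^n}(A_{j0}) for all j ∈ {0,…,q−1} and k ∈ {0,…,r−1}. -/
open Finset

/-- `chiX M m X = ∑_{x ∈ X} e^{2πi·m·x/M}`. -/
noncomputable def chiX (M : ℕ) (m : ℕ) (X : Finset (ZMod M)) : ℂ :=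
  ∑ x ∈ X, Complex.exp (2 * Real.pi * Complex.I * m * x.val / M)

/-- The fiber `A_{jk} = {x ∈ Z_{p^n} : (x, j, k) ∈ A}`. -/
def fiber (p q r n : ℕ) (A : Finset (ZMod (p ^ n) × ZMod q × ZMod r)) (j k : ℕ) :
    Finset (ZMod (p ^ n)) :=
  (A.filter fun g => g.2.1 = (j : ZMod q) ∧ g.2.2 = (k : ZMod r)).image Prod.fst

/-- `chiG p q r n m s t A = ∑_{(x,j,k) ∈ A} e^{2πi(m·x/p^n + s·j/q + t·k/r)}`. -/
noncomputable def chiG (p q r n : ℕ) (m s t : ℕ)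
    (A : Finset (ZMod (p ^ n) × ZMod q × ZMod r)) : ℂ :=
  ∑ g ∈ A, Complex.exp (2 * Real.pi * Complex.I *
    (m * g.1.val / (p ^ n : ℕ) + s * g.2.1.val / q + t * g.2.2.val / r))

open IntermediateField in
/-- Over `ℚ(ζ)`, with `ζ` a primitive `M`-th root of unity and `l` a prime not dividing `M`,
a primitive `l`-th root of unity has degree `l - 1`. -/
theorem natDegree_minpoly_adjoin_of_coprime {L : Type*} [Field L] [CharZero L] {M l : ℕ}
    (hM : 0 < M) (hl : l.Prime) (hMl : M.Coprime l) {ζ ω : L} (hζ : IsPrimitiveRoot ζ M)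
    (hω : IsPrimitiveRoot ω l) :
    (minpoly ℚ⟮ζ⟯ ω).natDegree = l - 1 := by
  have hζi : IsIntegral ℚ ζ := (hζ.isIntegral hM).tower_top
  have hωi : IsIntegral ℚ⟮ζ⟯ ω := (hω.isIntegral hl.pos).tower_top
  have hζd : Module.finrank ℚ ℚ⟮ζ⟯ = M.totient := by
    rw [adjoin.finrank hζi, ← Polynomial.cyclotomic_eq_minpoly_rat hζ hM,
      Polynomial.natDegree_cyclotomic]
  have : FiniteDimensional ℚ ℚ⟮ζ⟯ := adjoin.finiteDimensional hζi
  have : FiniteDimensional ℚ⟮ζ⟯ ℚ⟮ζ⟯⟮ω⟯ := adjoin.finiteDimensional hωi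
  have : FiniteDimensional ℚ ℚ⟮ζ⟯⟮ω⟯ := FiniteDimensional.trans ℚ ℚ⟮ζ⟯ ℚ⟮ζ⟯⟮ω⟯
  have hω' : IsPrimitiveRoot (AdjoinSimple.gen ℚ⟮ζ⟯ ω) l :=
    IsPrimitiveRoot.of_map_of_injective (f := algebraMap ℚ⟮ζ⟯⟮ω⟯ L) (by simpa using hω)
      (algebraMap ℚ⟮ζ⟯⟮ω⟯ L).injective
  have hζ' : IsPrimitiveRoot (algebraMap ℚ⟮ζ⟯ ℚ⟮ζ⟯⟮ω⟯ (AdjoinSimple.gen ℚ ζ)) M :=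
    IsPrimitiveRoot.of_map_of_injective (f := algebraMap ℚ⟮ζ⟯⟮ω⟯ L) (by simpa using hζ)
      (algebraMap ℚ⟮ζ⟯⟮ω⟯ L).injective
  have hlow := hζ'.lcm_totient_le_finrank (K := ℚ) hω'
    (Polynomial.cyclotomic.irreducible_rat (Nat.lcm_pos hM hl.pos))
  have : Module.Free ℚ⟮ζ⟯ ℚ⟮ζ⟯⟮ω⟯ := Module.Free.of_divisionRing _ _
  rw [hMl.lcm_eq_mul, Nat.totient_mul hMl, Nat.totient_prime hl,
    ← Module.finrank_mul_finrank ℚ ℚ⟮ζ⟯ ℚ⟮ζ⟯⟮ω⟯, hζd, adjoin.finrank hωi] at hlow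
  refine le_antisymm ?_ (Nat.le_of_mul_le_mul_left hlow (Nat.totient_pos.2 hM))
  have hdvd : minpoly ℚ⟮ζ⟯ ω ∣ Polynomial.cyclotomic l ℚ⟮ζ⟯ :=
    minpoly.dvd _ _ <| by
    have hr := hω.isRoot_cyclotomic hl.pos
    rwa [Polynomial.IsRoot, ← Polynomial.map_cyclotomic l (algebraMap ℚ⟮ζ⟯ L),
      Polynomial.eval_map_algebraMap] at hr
  have := Polynomial.natDegree_le_of_dvd hdvd (Polynomial.cyclotomic_ne_zero l _)
  rwa [Polynomial.natDegree_cyclotomic, Nat.totient_prime hl] at this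

open IntermediateField in
/-- A vanishing combination of the powers of a primitive `l`-th root of unity, with coefficients
in the `M`-th cyclotomic field for `M` prime to `l`, has constant coefficients. -/
theorem coeff_eq_of_sum_mul_pow_eq_zero {L : Type*} [Field L] [CharZero L] {M l : ℕ}
    (hM : 0 < M) (hl : l.Prime) (hMl : M.Coprime l) {ζ ω : L} (hζ : IsPrimitiveRoot ζ M)
    (hω : IsPrimitiveRoot ω l) (a : ℕ → L) (ha : ∀ j, a j ∈ ℚ⟮ζ⟯)
    (h : ∑ j ∈ range l, a j * ω ^ j = 0) : ∀ j < l, a j = a 0 := by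
  have hdeg := natDegree_minpoly_adjoin_of_coprime hM hl hMl hζ hω
  have hli := linearIndependent_pow (K := ℚ⟮ζ⟯) ω
  rw [hdeg, Fintype.linearIndependent_iff] at hli
  obtain ⟨m, rfl⟩ : ∃ m, l = m + 1 := ⟨l - 1, by have := hl.pos; omega⟩
  have hgeom := hω.geom_sum_eq_zero hl.one_lt
  have hsum : ∑ j ∈ range m, (a j - a m) * ω ^ j = 0 := by
    rw [sum_range_succ] at h hgeom
    simp only [sub_mul, sum_sub_distrib, ← mul_sum]
    linear_combination h - a m * hgeom
  have hall : ∀ j < m, a j = a m := by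
    intro j hj
    have := hli (fun i => ⟨a i - a m, sub_mem (ha i) (ha m)⟩)
      (by rw [← hsum]; simp [← Fin.sum_univ_eq_sum_range, IntermediateField.smul_def]) ⟨j, hj⟩
    exact sub_eq_zero.1 (congrArg Subtype.val this)
  have hlast : ∀ j < m + 1, a j = a m := by
    intro j hj
    rcases Nat.lt_succ_iff_lt_or_eq.1 hj with h | rfl
    exacts [hall j h, rfl]
  intro j hj
  rw [hlast j hj, hlast 0 hl.pos]

open Complex in
theorem exp_two_pi_mul_natCast_div (M a : ℕ) :
    exp (2 * Real.pi * I * a / M) = exp (2 * Real.pi * I / M) ^ a := by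
  rw [← exp_nat_mul]
  congr 1
  ring

open Complex IntermediateField in
theorem chiX_mem_adjoin (M m : ℕ) (X : Finset (ZMod M)) :
    chiX M m X ∈ ℚ⟮exp (2 * Real.pi * I / M)⟯ := by
  refine sum_mem fun x _ => ?_
  rw [show 2 * Real.pi * I * m * x.val / M = 2 * Real.pi * I * (m * x.val : ℕ) / M by
    push_cast; ring, exp_two_pi_mul_natCast_div]
  exact pow_mem (mem_adjoin_simple_self ℚ _) _

open Complex in
theorem chiG_eq_sum_chiX_fiber {p q r n : ℕ} (hq : 0 < q) (hr : 0 < r) (m s t : ℕ)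
    (A : Finset (ZMod (p ^ n) × ZMod q × ZMod r)) :
    chiG p q r n m s t A = ∑ k ∈ range r,
      (∑ j ∈ range q, chiX (p ^ n) m (fiber p q r n A j k) *
        (exp (2 * Real.pi * I / q) ^ s) ^ j) * (exp (2 * Real.pi * I / r) ^ t) ^ k := by
  have : NeZero q := ⟨hq.ne'⟩
  have : NeZero r := ⟨hr.ne'⟩
  rw [chiG, ← sum_fiberwise_of_maps_to (g := fun g => g.2.2.val) (t := range r)
    fun g _ => mem_range.2 g.2.2.val_lt]
  refine sum_congr rfl fun k hk => ?_
  rw [← sum_fiberwise_of_maps_to (g := fun g => g.2.1.val) (t := range q)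
    fun g _ => mem_range.2 g.2.1.val_lt, sum_mul]
  refine sum_congr rfl fun j hj => ?_
  have hval : ∀ {N : ℕ} [NeZero N] (x : ZMod N) (i : ℕ), i < N → (x = i ↔ x.val = i) := by
    intro N _ x i hi
    exact ⟨fun h => by rw [h, ZMod.val_cast_of_lt hi],
      fun h => by rw [← h, ZMod.natCast_zmod_val]⟩
  rw [chiX, fiber, sum_image, filter_filter, sum_mul, sum_mul]
  · refine sum_congr ?_ fun g hg => ?_
    · ext g
      simp only [mem_filter, hval _ _ (mem_range.1 hj), hval _ _ (mem_range.1 hk)]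
      tauto
    · simp only [mem_filter, hval _ _ (mem_range.1 hj), hval _ _ (mem_range.1 hk)] at hg
      rw [hg.2.1, hg.2.2, ← pow_mul, ← pow_mul, ← exp_two_pi_mul_natCast_div,
        ← exp_two_pi_mul_natCast_div, ← exp_add, ← exp_add]
      congr 1
      push_cast
      ring
  · intro g hg g' hg' h
    simp only [coe_filter, Set.mem_ofPred_eq] at hg hg'
    exact Prod.ext h (Prod.ext (hg.2.1.trans hg'.2.1.symm) (hg.2.2.trans hg'.2.2.symm))

theorem fiber_eq_of_two_zeros (p q r n : ℕ) (hp : p.Prime) (hq : q.Prime)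
    (hr : r.Prime) (hpq : p ≠ q) (hpr : p ≠ r) (hqr : q ≠ r) (hn : 0 < n)
    (A : Finset (ZMod (p ^ n) × ZMod q × ZMod r)) (i : ℕ) (hi : i ≤ n)
    (h1 : chiG p q r n (p ^ i) 1 1 A = 0)
    (h2 : chiG p q r n (p ^ i) 0 1 A = 0) :
    ∀ j < q, ∀ k < r,
      chiX (p ^ n) (p ^ i) (fiber p q r n A j k) =
        chiX (p ^ n) (p ^ i) (fiber p q r n A j 0) := by
  have hN : 0 < p ^ n := pow_pos hp.pos n
  have hNq : (p ^ n).Coprime q := Nat.Coprime.pow_left n ((Nat.coprime_primes hp hq).2 hpq)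
  have hNr : (p ^ n).Coprime r := Nat.Coprime.pow_left n ((Nat.coprime_primes hp hr).2 hpr)
  have hNqr : (p ^ n * q).Coprime r := hNr.mul_left ((Nat.coprime_primes hq hr).2 hqr)
  have hNqpos : 0 < p ^ n * q := Nat.mul_pos hN hq.pos
  have hζN := Complex.isPrimitiveRoot_exp (p ^ n) hN.ne'
  have hζNq := Complex.isPrimitiveRoot_exp (p ^ n * q) hNqpos.ne'
  have hζq := Complex.isPrimitiveRoot_exp q hq.ne_zero
  have hζr := Complex.isPrimitiveRoot_exp r hr.ne_zero
  have hmem := fun j k => chiX_mem_adjoin (p ^ n) (p ^ i) (fiber p q r n A j k)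
  rw [chiG_eq_sum_chiX_fiber hq.pos hr.pos] at h1 h2
  simp only [pow_one, pow_zero, one_pow, mul_one] at h1 h2
  generalize Complex.exp (2 * Real.pi * Complex.I / (p ^ n : ℕ)) = ζ at hζN hmem
  generalize Complex.exp (2 * Real.pi * Complex.I / (p ^ n * q : ℕ)) = ξ at hζNq
  generalize Complex.exp (2 * Real.pi * Complex.I / q) = η at hζq h1
  generalize Complex.exp (2 * Real.pi * Complex.I / r) = ω at hζr h1 h2
  generalize hF : (fun j k => chiX (p ^ n) (p ^ i) (fiber p q r n A j k)) = F
  simp only [funext_iff] at hF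
  simp only [hF] at h1 h2 hmem ⊢
  have hη : η ∈ IntermediateField.adjoin ℚ {ξ} := by
    have : NeZero (p ^ n * q) := ⟨hNqpos.ne'⟩
    obtain ⟨e, -, rfl⟩ := hζNq.eq_pow_of_pow_eq_one
      (show η ^ (p ^ n * q) = 1 by rw [mul_comm, pow_mul, hζq.pow_eq_one, one_pow])
    exact pow_mem (IntermediateField.mem_adjoin_simple_self ℚ _) _
  have hζ : IntermediateField.adjoin ℚ {ζ} ≤ IntermediateField.adjoin ℚ {ξ} := by
    rw [IntermediateField.adjoin_simple_le_iff]
    have : NeZero (p ^ n * q) := ⟨hNqpos.ne'⟩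
    obtain ⟨e, -, rfl⟩ := hζNq.eq_pow_of_pow_eq_one
      (show ζ ^ (p ^ n * q) = 1 by rw [pow_mul, hζN.pow_eq_one, one_pow])
    exact pow_mem (IntermediateField.mem_adjoin_simple_self ℚ _) _
  intro j hj k hk
  have hrow := coeff_eq_of_sum_mul_pow_eq_zero hNqpos hr hNqr hζNq hζr
    (fun k => ∑ j ∈ range q, F j k * η ^ j)
    (fun k => sum_mem fun j _ => mul_mem (hζ (hmem j k)) (pow_mem hη j)) h1 k hk
  have hsum := coeff_eq_of_sum_mul_pow_eq_zero hN hr hNr hζN hζr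
    (fun k => ∑ j ∈ range q, F j k) (fun k => sum_mem fun j _ => hmem j k) h2 k hk
  have hcol := coeff_eq_of_sum_mul_pow_eq_zero hN hq hNq hζN hζq (fun j => F j k - F j 0)
    (fun j => sub_mem (hmem j k) (hmem j 0))
    (by simpa [sub_mul, sum_sub_distrib, sub_eq_zero] using hrow)
  have hzero : ∑ j ∈ range q, (F j k - F j 0) = 0 := by
    simpa [sum_sub_distrib, sub_eq_zero] using hsum
  rw [sum_congr rfl fun j hj => hcol j (mem_range.1 hj), sum_const, card_range, nsmul_eq_mul,
    mul_eq_zero, or_iff_right (Nat.cast_ne_zero.2 hq.ne_zero)] at hzero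
  exact sub_eq_zero.1 ((hcol j hj).trans hzero)
end

section
/- Let A ⊆ G = Z_{p^n} × Z_q × Z_r and let i be an integer with 0 ≤ i ≤ n. If χ_{(p^i,1,1)}(A) = 0, χ_{(p^i,0,1)}(A) = 0, χ_{(p^i,1,0)}(A) = 0 and χ_{(p^i,0,0)}(A) = 0, then χ_{p^i,p^n}(A_{jk}) = 0 for all j ∈ {0,…,q−1} and k ∈ {0,…,r−1}. -/
open Finset

/-- If an integer polynomial vanishes at a primitive root of unity, it vanishes at every coprime
power of it. -/
theorem aeval_pow_coprime_eq_zero {M u : ℕ} {ξ : ℂ} (hξ : IsPrimitiveRoot ξ M) (hM : 0 < M)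
    (hu : u.Coprime M) {f : Polynomial ℤ} (hf : Polynomial.aeval ξ f = 0) :
    Polynomial.aeval (ξ ^ u) f = 0 := by
  obtain ⟨g, rfl⟩ := minpoly.isIntegrallyClosed_dvd (hξ.isIntegral hM) hf
  rw [hξ.minpoly_eq_pow_coprime hu, map_mul, minpoly.aeval, zero_mul]

theorem exp_eq_root_pow {P q r : ℕ} (hP : 0 < P) (hq : 0 < q) (hr : 0 < r)
    (m s t x j k : ℕ) :
    Complex.exp (2 * Real.pi * Complex.I * ((m : ℂ) * x / P + s * j / q + t * k / r)) =
      Complex.exp (2 * Real.pi * Complex.I / (P * q * r : ℕ)) ^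
        (m * x * (q * r) + s * j * (P * r) + t * k * (P * q)) := by
  rw [← Complex.exp_nat_mul]
  congr 1
  have : (P : ℂ) ≠ 0 := by exact_mod_cast hP.ne'
  have : (q : ℂ) ≠ 0 := by exact_mod_cast hq.ne'
  have : (r : ℂ) ≠ 0 := by exact_mod_cast hr.ne'
  push_cast
  field_simp

theorem chiG_mul_coprime_eq_zero {p q r n : ℕ} (hp : 0 < p) (hq : 0 < q) (hr : 0 < r)
    {m s t u : ℕ} {A : Finset (ZMod (p ^ n) × ZMod q × ZMod r)}
    (hu : u.Coprime (p ^ n * q * r)) (h : chiG p q r n m s t A = 0) :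
    chiG p q r n (u * m) (u * s) (u * t) A = 0 := by
  have hP : 0 < p ^ n := pow_pos hp n
  have hM : 0 < p ^ n * q * r := by positivity
  unfold chiG at h ⊢
  simp_rw [exp_eq_root_pow hP hq hr] at h ⊢
  have key := aeval_pow_coprime_eq_zero (Complex.isPrimitiveRoot_exp _ hM.ne') hM hu
    (f := ∑ g ∈ A, Polynomial.X ^ (m * g.1.val * (q * r) + s * g.2.1.val * (p ^ n * r) +
      t * g.2.2.val * (p ^ n * q))) (by simpa using h)
  simp only [map_sum, map_pow, Polynomial.aeval_X, ← pow_mul] at key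
  rw [← key]
  refine Finset.sum_congr rfl fun g _ => ?_
  congr 1
  ring

theorem exp_congr_of_modEq {N a b : ℕ} (hN : 0 < N) (h : a ≡ b [MOD N]) (x : ℕ) :
    Complex.exp (2 * Real.pi * Complex.I * ((a : ℂ) * x / N)) =
      Complex.exp (2 * Real.pi * Complex.I * ((b : ℂ) * x / N)) := by
  have hζ := Complex.isPrimitiveRoot_exp N hN.ne'
  have key (c : ℕ) : Complex.exp (2 * Real.pi * Complex.I * ((c : ℂ) * x / N)) =
      (Complex.exp (2 * Real.pi * Complex.I / N) ^ c) ^ x := by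
    rw [← pow_mul, ← Complex.exp_nat_mul]
    congr 1
    push_cast
    ring
  rw [key, key, ← pow_mod_orderOf _ a, ← pow_mod_orderOf _ b, ← hζ.eq_orderOf,
    show a % N = b % N from h]

theorem chiG_congr {p q r n : ℕ} (hp : 0 < p) (hq : 0 < q) (hr : 0 < r)
    {m s t m' s' t' : ℕ} (hm : m ≡ m' [MOD p ^ n]) (hs : s ≡ s' [MOD q]) (ht : t ≡ t' [MOD r])
    (A : Finset (ZMod (p ^ n) × ZMod q × ZMod r)) :
    chiG p q r n m s t A = chiG p q r n m' s' t' A := by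
  refine Finset.sum_congr rfl fun g _ => ?_
  simp only [mul_add, Complex.exp_add]
  rw [exp_congr_of_modEq (pow_pos hp n) hm, exp_congr_of_modEq hq hs, exp_congr_of_modEq hr ht]

/-- Every residue modulo a prime is a unit times `0` or `1`. -/
theorem exists_coprime_mul_modEq {q : ℕ} (hq : q.Prime) (s : ℕ) :
    ∃ u ε : ℕ, u.Coprime q ∧ (ε = 0 ∨ ε = 1) ∧ u * ε ≡ s [MOD q] := by
  by_cases h : q ∣ s
  · exact ⟨1, 0, Nat.coprime_one_left q, Or.inl rfl, by
      simpa using ((Nat.modEq_zero_iff_dvd).2 h).symm⟩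
  · exact ⟨s, 1, ((Nat.Prime.coprime_iff_not_dvd hq).2 h).symm, Or.inr rfl, by
      simpa using Nat.ModEq.refl s⟩

theorem chiG_eq_zero_of_four_zeros {p q r n : ℕ} (hp : p.Prime) (hq : q.Prime)
    (hr : r.Prime) (hpq : p ≠ q) (hpr : p ≠ r) (hqr : q ≠ r)
    {A : Finset (ZMod (p ^ n) × ZMod q × ZMod r)} {m : ℕ}
    (h : ∀ ε δ : ℕ, (ε = 0 ∨ ε = 1) → (δ = 0 ∨ δ = 1) → chiG p q r n m ε δ A = 0) (s t : ℕ) :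
    chiG p q r n m s t A = 0 := by
  obtain ⟨v, ε, hv, hε, hvs⟩ := exists_coprime_mul_modEq hq s
  obtain ⟨w, δ, hw, hδ, hwt⟩ := exists_coprime_mul_modEq hr t
  have hPq : (p ^ n).Coprime q := Nat.Coprime.pow_left n ((Nat.coprime_primes hp hq).2 hpq)
  have hPr : (p ^ n).Coprime r := Nat.Coprime.pow_left n ((Nat.coprime_primes hp hr).2 hpr)
  have hqr' : q.Coprime r := (Nat.coprime_primes hq hr).2 hqr
  obtain ⟨c, hcP, hcq⟩ := Nat.chineseRemainder hPq 1 v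
  obtain ⟨u, huc, hur⟩ := Nat.chineseRemainder (Nat.Coprime.mul_left hPr hqr') c w
  have huP : u ≡ 1 [MOD p ^ n] := (huc.of_dvd (dvd_mul_right _ _)).trans hcP
  have huq : u ≡ v [MOD q] := (huc.of_dvd (dvd_mul_left _ _)).trans hcq
  have hu : u.Coprime (p ^ n * q * r) := by
    refine Nat.Coprime.mul_right (Nat.Coprime.mul_right ?_ ?_) ?_
    · rw [Nat.Coprime, huP.gcd_eq, Nat.gcd_one_left]
    · rw [Nat.Coprime, huq.gcd_eq, hv]
    · rw [Nat.Coprime, hur.gcd_eq, hw]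
  rw [← chiG_mul_coprime_eq_zero hp.pos hq.pos hr.pos hu (h ε δ hε hδ)]
  refine chiG_congr hp.pos hq.pos hr.pos ?_ ?_ ?_ A
  · simpa using (huP.mul_right m).symm
  · exact ((huq.mul_right ε).trans hvs).symm
  · exact ((hur.mul_right δ).trans hwt).symm

theorem sum_exp_eq_ite {N : ℕ} (hN : 0 < N) (a : ℕ) :
    ∑ s ∈ Finset.range N, Complex.exp (2 * Real.pi * Complex.I * ((s : ℂ) * a / N)) =
      if N ∣ a then (N : ℂ) else 0 := by
  have hζ := Complex.isPrimitiveRoot_exp N hN.ne'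
  set ζ := Complex.exp (2 * Real.pi * Complex.I / N) with hζdef
  have key (s : ℕ) : Complex.exp (2 * Real.pi * Complex.I * ((s : ℂ) * a / N)) = (ζ ^ a) ^ s := by
    rw [← pow_mul, hζdef, ← Complex.exp_nat_mul]
    congr 1
    push_cast
    ring
  simp_rw [key]
  split_ifs with h
  · simp [(hζ.pow_eq_one_iff_dvd a).2 h]
  · have hne : ζ ^ a - 1 ≠ 0 := sub_ne_zero.2 fun e => h ((hζ.pow_eq_one_iff_dvd a).1 e)
    refine (mul_eq_zero.1 ?_).resolve_right hne
    rw [geom_sum_mul, ← pow_mul, mul_comm, pow_mul, hζ.pow_eq_one, one_pow, sub_self]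

theorem dvd_val_add_sub_iff {N : ℕ} [NeZero N] (x : ZMod N) {j : ℕ} (hj : j < N) :
    N ∣ x.val + (N - j) ↔ x = j := by
  rw [← ZMod.natCast_eq_zero_iff, Nat.cast_add, Nat.cast_sub hj.le, ZMod.natCast_zmod_val,
    ZMod.natCast_self, zero_sub, ← sub_eq_add_neg, sub_eq_zero]

theorem chiX_fiber (p q r n m j k : ℕ) (A : Finset (ZMod (p ^ n) × ZMod q × ZMod r)) :
    chiX (p ^ n) m (fiber p q r n A j k) =
      ∑ g ∈ A, if g.2.1 = (j : ZMod q) ∧ g.2.2 = (k : ZMod r) then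
        Complex.exp (2 * Real.pi * Complex.I * (m * g.1.val / (p ^ n : ℕ))) else 0 := by
  unfold chiX fiber
  rw [Finset.sum_image, Finset.sum_filter]
  · refine Finset.sum_congr rfl fun g _ => ?_
    simp only [mul_assoc, mul_div_assoc]
  · rintro ⟨x, y, z⟩ hx ⟨x', y', z'⟩ hx' h
    simp_all

/-- Fourier inversion in the last two coordinates. -/
theorem sum_chiG_mul_exp {p q r n : ℕ} (hq : 0 < q) (hr : 0 < r) (m : ℕ) {j k : ℕ}
    (hj : j < q) (hk : k < r) (A : Finset (ZMod (p ^ n) × ZMod q × ZMod r)) :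
    ∑ s ∈ Finset.range q, ∑ t ∈ Finset.range r, chiG p q r n m s t A *
      Complex.exp (2 * Real.pi * Complex.I *
        ((s : ℂ) * (q - j : ℕ) / q + t * (r - k : ℕ) / r)) =
      q * r * chiX (p ^ n) m (fiber p q r n A j k) := by
  have : NeZero q := ⟨hq.ne'⟩
  have : NeZero r := ⟨hr.ne'⟩
  have split (g : ZMod (p ^ n) × ZMod q × ZMod r) (s t : ℕ) :
      Complex.exp (2 * Real.pi * Complex.I *
        (m * g.1.val / (p ^ n : ℕ) + s * g.2.1.val / q + t * g.2.2.val / r)) *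
      Complex.exp (2 * Real.pi * Complex.I *
        ((s : ℂ) * (q - j : ℕ) / q + t * (r - k : ℕ) / r)) =
      Complex.exp (2 * Real.pi * Complex.I * (m * g.1.val / (p ^ n : ℕ))) *
      (Complex.exp (2 * Real.pi * Complex.I * ((s : ℂ) * (g.2.1.val + (q - j) : ℕ) / q)) *
      Complex.exp (2 * Real.pi * Complex.I * ((t : ℂ) * (g.2.2.val + (r - k) : ℕ) / r))) := by
    rw [← Complex.exp_add, ← Complex.exp_add, ← Complex.exp_add, Nat.cast_add, Nat.cast_add]
    congr 1
    ring
  simp_rw [chiG, Finset.sum_mul, split]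
  rw [chiX_fiber, Finset.mul_sum, Finset.sum_congr rfl fun s _ => Finset.sum_comm,
    Finset.sum_comm]
  refine Finset.sum_congr rfl fun g _ => ?_
  simp_rw [← Finset.mul_sum]
  rw [← Finset.sum_mul, sum_exp_eq_ite hq, sum_exp_eq_ite hr]
  simp only [dvd_val_add_sub_iff _ hj, dvd_val_add_sub_iff _ hk]
  by_cases h₁ : g.2.1 = (j : ZMod q) <;> by_cases h₂ : g.2.2 = (k : ZMod r) <;>
    simp [h₁, h₂, mul_comm]

theorem fiber_zero_of_four_zeros (p q r n : ℕ) (hp : p.Prime) (hq : q.Prime)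
    (hr : r.Prime) (hpq : p ≠ q) (hpr : p ≠ r) (hqr : q ≠ r) (hn : 0 < n)
    (A : Finset (ZMod (p ^ n) × ZMod q × ZMod r)) (i : ℕ) (hi : i ≤ n)
    (h1 : chiG p q r n (p ^ i) 1 1 A = 0)
    (h2 : chiG p q r n (p ^ i) 0 1 A = 0)
    (h3 : chiG p q r n (p ^ i) 1 0 A = 0)
    (h4 : chiG p q r n (p ^ i) 0 0 A = 0) :
    ∀ j < q, ∀ k < r, chiX (p ^ n) (p ^ i) (fiber p q r n A j k) = 0 := by
  have h := chiG_eq_zero_of_four_zeros hp hq hr hpq hpr hqr (A := A) (m := p ^ i) (by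
    rintro ε δ (rfl | rfl) (rfl | rfl) <;> assumption)
  intro j hj k hk
  have key := sum_chiG_mul_exp hq.pos hr.pos (p ^ i) hj hk A
  simp only [h, zero_mul, Finset.sum_const_zero] at key
  have hqr0 : (q : ℂ) * r ≠ 0 := by
    exact_mod_cast (Nat.mul_pos hq.pos hr.pos).ne'
  exact (mul_eq_zero.1 key.symm).resolve_left hqr0
end
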